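/- arXiv:2511.03545 — 2 statements merged into one kernel-verified Lean document; each statement's English description precedes it below -/
import Mathlib

section
/- Let T be a decision tree over a finite feature set F in which no feature labels two distinct inner nodes on the same root-to-leaf path, let e be an example over F, and let A ⊆ F. Then A is a local abductive explanation for e w.r.t. the model computed by T if and only if every leaf l of T whose path assignment α_T^l is consistent with e on A (i.e., α_T^l(f) = e(f) for every f ∈ A on which α_T^l is defined) has label T(e). -/
/-- A decision tree over feature set `F`. -/
inductive DTree (F : Type*) where
  | leaf : Bool → DTree F
  | node : F → DTree F → DTree F → DTree F

namespace DTree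

/-- Classification of an example by a decision tree. -/
def eval {F : Type*} : DTree F → (F → Bool) → Bool
  | leaf b, _ => b
  | node f t0 t1, e => if e f then t1.eval e else t0.eval e

/-- The list of features occurring at inner nodes of a decision tree. -/
def features {F : Type*} : DTree F → List F
  | leaf _ => []
  | node f t0 t1 => f :: (t0.features ++ t1.features)

/-- The leaves of a decision tree, each together with its path assignment `α_T^l`
(the list of (feature, value) pairs along the root-to-leaf path) and its label. -/
def leavesWithPath {F : Type*} : DTree F → List (List (F × Bool) × Bool)
  | leaf b => [([], b)]
  | node f t0 t1 =>
      (t0.leavesWithPath.map fun pb => ((f, false) :: pb.1, pb.2)) ++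
      (t1.leavesWithPath.map fun pb => ((f, true) :: pb.1, pb.2))

/-- No feature labels two distinct inner nodes on the same root-to-leaf path. -/
def NonRedundant {F : Type*} : DTree F → Prop
  | leaf _ => True
  | node f t0 t1 =>
      f ∉ t0.features ∧ f ∉ t1.features ∧ t0.NonRedundant ∧ t1.NonRedundant

end DTree

/-- `A` is a local abductive explanation (lAXp) for example `e` w.r.t. model `M`. -/
def IsLAXp {F : Type*} (M : (F → Bool) → Bool) (e : F → Bool) (A : Set F) : Prop :=
  ∀ e' : F → Bool, (∀ f ∈ A, e' f = e f) → M e' = M e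

namespace DTree

variable {F : Type*}

/-- The path assignment of some leaf labeled `T.eval e` is consistent with `e`. -/
theorem exists_mem_leavesWithPath (T : DTree F) (e : F → Bool) :
    ∃ p, (p, T.eval e) ∈ T.leavesWithPath ∧ ∀ fb ∈ p, fb.2 = e fb.1 := by
  induction T with
  | leaf b => exact ⟨[], by simp [leavesWithPath, eval]⟩
  | node f t0 t1 ih0 ih1 =>
    cases h : e f with
    | false =>
      obtain ⟨p, hp, hpe⟩ := ih0
      refine ⟨(f, false) :: p, ?_, List.forall_mem_cons.2 ⟨h.symm, hpe⟩⟩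
      simpa [leavesWithPath, eval, h] using hp
    | true =>
      obtain ⟨p, hp, hpe⟩ := ih1
      refine ⟨(f, true) :: p, ?_, List.forall_mem_cons.2 ⟨h.symm, hpe⟩⟩
      simpa [leavesWithPath, eval, h] using hp

/-- An example extending the path assignment of a leaf is classified by the label of that leaf. -/
theorem eval_eq_of_mem_leavesWithPath {T : DTree F} {e : F → Bool} {p : List (F × Bool)}
    {c : Bool} (h : (p, c) ∈ T.leavesWithPath) (hp : ∀ fb ∈ p, fb.2 = e fb.1) :
    T.eval e = c := by
  induction T generalizing p with
  | leaf b => simp_all [leavesWithPath, eval]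
  | node f t0 t1 ih0 ih1 =>
    simp only [leavesWithPath, List.mem_append, List.mem_map, Prod.mk.injEq, Prod.exists] at h
    rcases h with ⟨q, _, hq, rfl, rfl⟩ | ⟨q, _, hq, rfl, rfl⟩
    all_goals
      obtain ⟨hf, hqe⟩ := List.forall_mem_cons.1 hp
      simp only at hf
    · simpa [eval, ← hf] using ih0 hq hqe
    · simpa [eval, ← hf] using ih1 hq hqe

theorem fst_mem_features {T : DTree F} {p : List (F × Bool)} {c : Bool}
    (h : (p, c) ∈ T.leavesWithPath) {fb : F × Bool} (hfb : fb ∈ p) : fb.1 ∈ T.features := by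
  induction T generalizing p with
  | leaf b => simp_all [leavesWithPath]
  | node f t0 t1 ih0 ih1 =>
    simp only [leavesWithPath, List.mem_append, List.mem_map, Prod.mk.injEq, Prod.exists] at h
    simp only [features, List.mem_cons, List.mem_append]
    rcases h with ⟨q, _, hq, rfl, rfl⟩ | ⟨q, _, hq, rfl, rfl⟩
    · rcases List.mem_cons.1 hfb with rfl | hfb
      · exact Or.inl rfl
      · exact Or.inr (Or.inl (ih0 hq hfb))
    · rcases List.mem_cons.1 hfb with rfl | hfb
      · exact Or.inl rfl
      · exact Or.inr (Or.inr (ih1 hq hfb))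

/-- In a non-redundant tree, a path assigns no feature twice. -/
theorem NonRedundant.nodup_map_fst {T : DTree F} (hT : T.NonRedundant) {p : List (F × Bool)}
    {c : Bool} (h : (p, c) ∈ T.leavesWithPath) : (p.map Prod.fst).Nodup := by
  induction T generalizing p with
  | leaf b => simp_all [leavesWithPath]
  | node f t0 t1 ih0 ih1 =>
    obtain ⟨h0, h1, hT0, hT1⟩ := hT
    simp only [leavesWithPath, List.mem_append, List.mem_map, Prod.mk.injEq, Prod.exists] at h
    rcases h with ⟨q, _, hq, rfl, rfl⟩ | ⟨q, _, hq, rfl, rfl⟩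
    · refine List.nodup_cons.2 ⟨fun hf => h0 ?_, ih0 hT0 hq⟩
      obtain ⟨fb, hfb, rfl⟩ := List.mem_map.1 hf
      exact fst_mem_features hq hfb
    · refine List.nodup_cons.2 ⟨fun hf => h1 ?_, ih1 hT1 hq⟩
      obtain ⟨fb, hfb, rfl⟩ := List.mem_map.1 hf
      exact fst_mem_features hq hfb

end DTree

/-- Overwriting an example by a partial assignment without repeated features. -/
theorem exists_overwrite_of_nodup_map_fst {F : Type*} (e : F → Bool) {p : List (F × Bool)}
    (hp : (p.map Prod.fst).Nodup) :
    ∃ e' : F → Bool, (∀ fb ∈ p, fb.2 = e' fb.1) ∧ ∀ f, e' f = e f ∨ (f, e' f) ∈ p := by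
  classical
  induction p with
  | nil => exact ⟨e, by simp⟩
  | cons gb p ih =>
    obtain ⟨hg, hp⟩ := List.nodup_cons.1 hp
    obtain ⟨e', hpe, he⟩ := ih hp
    refine ⟨Function.update e' gb.1 gb.2, List.forall_mem_cons.2 ⟨by simp, fun fb hfb => ?_⟩,
      fun f => ?_⟩
    · have hne : fb.1 ≠ gb.1 := fun h => hg (h ▸ List.mem_map_of_mem hfb)
      rw [Function.update_of_ne hne, hpe fb hfb]
    · by_cases hf : f = gb.1
      · subst hf
        simp
      · rw [Function.update_of_ne hf]
        exact (he f).imp_right (List.mem_cons_of_mem _)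

theorem stmt12 (F : Type*) (T : DTree F) (hT : T.NonRedundant)
    (e : F → Bool) (A : Set F) :
    IsLAXp T.eval e A ↔
      ∀ p : List (F × Bool), ∀ c : Bool, (p, c) ∈ T.leavesWithPath →
        (∀ fb ∈ p, fb.1 ∈ A → fb.2 = e fb.1) → c = T.eval e := by
  constructor
  · intro h p c hpc hp
    obtain ⟨e', hpe, he⟩ := exists_overwrite_of_nodup_map_fst e (hT.nodup_map_fst hpc)
    rw [← DTree.eval_eq_of_mem_leavesWithPath hpc hpe]
    exact h e' fun f hf => (he f).elim id fun hmem => hp _ hmem hf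
  · intro h e' he
    obtain ⟨p, hp, hpe⟩ := T.exists_mem_leavesWithPath e'
    exact h p _ hp fun fb hfb hA => (hpe fb hfb).trans (he _ hA)
end

section
/- Let L be a decision list over a finite feature set F, let e be an example over F, let r_i = (t_i, c_i) be the first rule of L whose term applies to e, and let R be the set of rules of L whose class differs from c_i. For A ⊆ F let e_A be the example obtained from e by flipping its value on exactly the features in A. Then: (1) for every rule r ∈ R and every set A ⊆ F such that r is the first rule of L whose term applies to e_A, the set A is a local contrastive explanation for e w.r.t. L; and (2) every local contrastive explanation A for e w.r.t. L contains a subset A' ⊆ A such that the first rule of L whose term applies to e_{A'} belongs to R. -/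
/-- A term over feature set `F`: a list of literals `(f, z)`. -/
abbrev DTerm (F : Type*) := List (F × Bool)

/-- A term applies to an example `e` if `e f = z` for each of its literals. -/
def termApplies {F : Type*} (t : DTerm F) (e : F → Bool) : Prop :=
  ∀ fb ∈ t, e fb.1 = fb.2

instance {F : Type*} (t : DTerm F) (e : F → Bool) : Decidable (termApplies t e) :=
  List.decidableBAll _ t

/-- The first rule of a decision list whose term applies to `e`. -/
def firstRule {F : Type*} : List (DTerm F × Bool) → (F → Bool) → Option (DTerm F × Bool)
  | [], _ => none
  | r :: rest, e => if termApplies r.1 e then some r else firstRule rest e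

/-- Classification by a decision list: the class of the first rule whose term
applies to `e`. -/
def dlEval {F : Type*} (L : List (DTerm F × Bool)) (e : F → Bool) : Bool :=
  match firstRule L e with
  | some r => r.2
  | none => false

/-- `A` is a local contrastive explanation (lCXp) for example `e` w.r.t. model `M`. -/
def IsLCXp {F : Type*} (M : (F → Bool) → Bool) (e : F → Bool) (A : Set F) : Prop :=
  ∃ e' : F → Bool, M e' ≠ M e ∧ ∀ f : F, e' f ≠ e f → f ∈ A

/-- The example obtained from `e` by flipping its value on exactly the features in `A`. -/
def flipOn {F : Type*} [DecidableEq F] (e : F → Bool) (A : Finset F) : F → Bool :=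
  fun f => if f ∈ A then ! e f else e f

theorem exists_firstRule_eq_some {F : Type*} (L : List (DTerm F × Bool)) (hne : L ≠ [])
    (hlast : (L.getLast hne).1 = []) (e : F → Bool) : ∃ r, firstRule L e = some r := by
  induction L with
  | nil => exact absurd rfl hne
  | cons a l ih =>
    by_cases ha : termApplies a.1 e
    · exact ⟨a, by simp [firstRule, ha]⟩
    · cases l with
      | nil =>
        have h : a.1 = [] := by simpa using hlast
        exact absurd (by simp [termApplies, h]) ha
      | cons b l =>
        obtain ⟨r, hr⟩ := ih (List.cons_ne_nil b l) (by simpa using hlast)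
        exact ⟨r, by rw [firstRule, if_neg ha, hr]⟩

theorem dlEval_of_firstRule_eq_some {F : Type*} {L : List (DTerm F × Bool)} {e : F → Bool}
    {r : DTerm F × Bool} (h : firstRule L e = some r) : dlEval L e = r.2 := by
  simp [dlEval, h]

theorem flipOn_filter_ne {F : Type*} [Fintype F] [DecidableEq F] (e e' : F → Bool) :
    flipOn e (Finset.univ.filter fun f => e' f ≠ e f) = e' := by
  funext f
  cases h : e f <;> cases h' : e' f <;> simp [flipOn, h, h']

theorem stmt16 (F : Type*) [Fintype F] [DecidableEq F]
    (L : List (DTerm F × Bool)) (hne : L ≠ [])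
    (hlast : (L.getLast hne).1 = [])
    (e : F → Bool) (ri : DTerm F × Bool) (hri : firstRule L e = some ri) :
    (∀ r ∈ L, r.2 ≠ ri.2 → ∀ A : Finset F,
        firstRule L (flipOn e A) = some r → IsLCXp (dlEval L) e (↑A : Set F)) ∧
    (∀ A : Finset F, IsLCXp (dlEval L) e (↑A : Set F) →
        ∃ A' ⊆ A, ∃ r : DTerm F × Bool,
          firstRule L (flipOn e A') = some r ∧ r.2 ≠ ri.2) := by
  constructor
  · intro r _ hr A hA
    refine ⟨flipOn e A, ?_, fun f hf => ?_⟩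
    · rwa [dlEval_of_firstRule_eq_some hA, dlEval_of_firstRule_eq_some hri]
    · by_contra hfA
      exact hf (if_neg hfA)
  · rintro A ⟨e', he', hA⟩
    obtain ⟨r, hr⟩ := exists_firstRule_eq_some L hne hlast e'
    refine ⟨Finset.univ.filter fun f => e' f ≠ e f, fun f hf => ?_, r, ?_, ?_⟩
    · exact hA f (Finset.mem_filter.mp hf).2
    · rwa [flipOn_filter_ne]
    · rwa [dlEval_of_firstRule_eq_some hr, dlEval_of_firstRule_eq_some hri] at he'
end
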